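/- Coherence of the negative left BAVaR: let α ∈ (0,1), let x ∈ X, and let π be a policy that is α-coherent for every reward function r ∈ ℝ^{X×A×X} (e.g. any deterministic policy). Define ρ(r) = −(1−γ) V₁^π(x; r). Then ρ is a coherent risk measure on ℝ^{X×A×X}, i.e.: (a) translation invariance: ρ(r + β·𝟏) = ρ(r) − β for all β ∈ ℝ; (b) sub-additivity: ρ(r₁ + r₂) ≤ ρ(r₁) + ρ(r₂) for all reward functions r₁, r₂; (c) positive homogeneity: ρ(β·r) = β·ρ(r) for all β ≥ 0; (d) monotonicity: if r₁ ≤ r₂ pointwise then ρ(r₁) ≥ ρ(r₂). -/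

import Mathlib

open MeasureTheory ProbabilityTheory Finset Set

noncomputable section

/-- Quantile (generalized inverse distribution) function of a measure on `ℝ`. -/
def quantileFn (ν : Measure ℝ) (τ : ℝ) : ℝ :=
  sInf {z : ℝ | τ ≤ cdf ν z}

/-- Left average value-at-risk at level `α`. -/
def avarLeft (α : ℝ) (ν : Measure ℝ) : ℝ :=
  (1 / α) * ∫ τ in (0:ℝ)..α, quantileFn ν τ

/-- Right average value-at-risk at level `1 - α`. -/
def avarRight (α : ℝ) (ν : Measure ℝ) : ℝ :=
  (1 / (1 - α)) * ∫ τ in α..(1:ℝ), quantileFn ν τ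

/-- A measure on `ℝ` with bounded support. -/
def HasBoundedSupport (ν : Measure ℝ) : Prop :=
  ∃ a b : ℝ, ν (Set.Icc a b)ᶜ = 0

/-- Finite Markov decision process with fixed state and action spaces. -/
structure MDP (X A : Type) [Fintype X] [Fintype A] where
  P : X → A → X → ℝ
  r : X → A → X → ℝ
  γ : ℝ
  P_nonneg : ∀ x a x', 0 ≤ P x a x'
  P_sum_one : ∀ x a, ∑ x', P x a x' = 1
  γ_nonneg : 0 ≤ γ
  γ_lt_one : γ < 1

variable {X A : Type} [Fintype X] [Fintype A]

/-- A stationary Markovian policy. -/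
def IsPolicy (π : X → A → ℝ) : Prop :=
  (∀ x a, 0 ≤ π x a) ∧ ∀ x, ∑ a, π x a = 1

/-- The discrete measure `(T^π D_{α,Q})^{(x,a)}`. -/
def diatomicMeasure (M : MDP X A) (α : ℝ) (π : X → A → ℝ)
    (Q : X → A → ℝ × ℝ) (x : X) (a : A) : Measure ℝ :=
  ∑ x' : X, ∑ a' : A, ENNReal.ofReal (M.P x a x' * π x' a') •
    (ENNReal.ofReal α • Measure.dirac (M.r x a x' + M.γ * (Q x' a').1)
      + ENNReal.ofReal (1 - α) • Measure.dirac (M.r x a x' + M.γ * (Q x' a').2))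

/-- The diatomic Bellman operator `T^π_α`. -/
def diatomicT (M : MDP X A) (α : ℝ) (π : X → A → ℝ)
    (Q : X → A → ℝ × ℝ) : X → A → ℝ × ℝ :=
  fun x a => (avarLeft α (diatomicMeasure M α π Q x a),
              avarRight α (diatomicMeasure M α π Q x a))

/-! ### Quantile functions and the Rockafellar–Uryasev formula -/

lemma quantileFn_le_iff (ν : Measure ℝ) {τ : ℝ} (hτ : τ ∈ Set.Ioo (0:ℝ) 1) (z : ℝ) :
    quantileFn ν τ ≤ z ↔ τ ≤ cdf ν z := by
  have hne : {z : ℝ | τ ≤ cdf ν z}.Nonempty :=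
    (((tendsto_cdf_atTop ν).eventually (lt_mem_nhds hτ.2)).mono fun _ h => h.le).exists
  obtain ⟨b, hb⟩ := ((tendsto_cdf_atBot ν).eventually (gt_mem_nhds hτ.1)).exists
  have hbdd : BddBelow {z : ℝ | τ ≤ cdf ν z} := by
    refine ⟨b, fun z hz => ?_⟩
    by_contra! h
    exact absurd (hz.trans (monotone_cdf ν h.le)) (not_le.2 hb)
  refine ⟨fun h => ?_, fun h => csInf_le hbdd h⟩
  have hright : Filter.Tendsto (cdf ν) (nhdsWithin z (Set.Ioi z)) (nhds (cdf ν z)) :=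
    ((cdf ν).right_continuous z).mono_left (nhdsWithin_mono _ Set.Ioi_subset_Ici_self)
  refine ge_of_tendsto hright ?_
  filter_upwards [self_mem_nhdsWithin] with w hw
  obtain ⟨u, hu, huw⟩ := exists_lt_of_csInf_lt hne (lt_of_le_of_lt h hw)
  exact le_trans hu (monotone_cdf ν huw.le)

lemma monotoneOn_quantileFn (ν : Measure ℝ) : MonotoneOn (quantileFn ν) (Set.Ioo 0 1) := by
  intro σ hσ τ hτ h
  rw [quantileFn_le_iff ν hσ]
  exact h.trans ((quantileFn_le_iff ν hτ _).1 le_rfl)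

lemma aemeasurable_quantileFn (ν : Measure ℝ) :
    AEMeasurable (quantileFn ν) (volume.restrict (Set.Ioo 0 1)) :=
  aemeasurable_restrict_of_monotoneOn measurableSet_Ioo (monotoneOn_quantileFn ν)

lemma map_quantileFn (ν : Measure ℝ) [IsProbabilityMeasure ν] :
    Measure.map (quantileFn ν) (volume.restrict (Set.Ioo 0 1)) = ν := by
  have : IsProbabilityMeasure (volume.restrict (Set.Ioo (0:ℝ) 1)) := ⟨by simp⟩
  have := Measure.isProbabilityMeasure_map (aemeasurable_quantileFn ν)
  refine Measure.ext_of_Iic _ _ fun z => ?_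
  rw [Measure.map_apply_of_aemeasurable (aemeasurable_quantileFn ν) measurableSet_Iic,
    ← ofReal_cdf ν z, Measure.restrict_apply₀']
  · have hset : quantileFn ν ⁻¹' Set.Iic z ∩ Set.Ioo 0 1 = Set.Iic (cdf ν z) ∩ Set.Ioo 0 1 := by
      ext τ
      simp only [Set.mem_inter_iff, Set.mem_preimage, Set.mem_Iic]
      exact and_congr_left fun hτ => quantileFn_le_iff ν hτ z
    rw [hset]
    refine le_antisymm ?_ ?_
    · calc _ ≤ volume (Set.Ioc 0 (cdf ν z)) :=
            measure_mono fun τ hτ => ⟨hτ.2.1, hτ.1⟩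
        _ = _ := by simp
    · calc ENNReal.ofReal (cdf ν z) = volume (Set.Ioo 0 (cdf ν z)) := by simp
        _ ≤ volume (Set.Iic (cdf ν z) ∩ Set.Ioo 0 1) := measure_mono fun τ hτ =>
            ⟨hτ.2.le, hτ.1, hτ.2.trans_le (cdf_le_one ν z)⟩
  · exact measurableSet_Ioo.nullMeasurableSet

lemma integral_comp_quantileFn (ν : Measure ℝ) [IsProbabilityMeasure ν] {g : ℝ → ℝ}
    (hg : Continuous g) : ∫ τ in (0:ℝ)..1, g (quantileFn ν τ) = ∫ z, g z ∂ν := by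
  rw [intervalIntegral.integral_of_le zero_le_one, integral_Ioc_eq_integral_Ioo]
  conv_rhs => rw [← map_quantileFn ν]
  rw [integral_map (aemeasurable_quantileFn ν) hg.aestronglyMeasurable]

lemma intervalIntegrable_quantileFn (ν : Measure ℝ) [IsProbabilityMeasure ν]
    (hν : Integrable id ν) {a b : ℝ} (ha : a ∈ Set.Icc (0:ℝ) 1) (hb : b ∈ Set.Icc (0:ℝ) 1) :
    IntervalIntegrable (quantileFn ν) volume a b := by
  have h : IntervalIntegrable (quantileFn ν) volume 0 1 := by
    rw [intervalIntegrable_iff_integrableOn_Ioo_of_le zero_le_one]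
    rw [← map_quantileFn ν] at hν
    exact hν.comp_aemeasurable (aemeasurable_quantileFn ν)
  refine h.mono_set ?_
  rw [Set.uIcc_of_le zero_le_one]
  exact Set.uIcc_subset_Icc ha hb

lemma avarLeft_add_avarRight (ν : Measure ℝ) [IsProbabilityMeasure ν] (hν : Integrable id ν)
    {α : ℝ} (hα : α ∈ Set.Ioo (0:ℝ) 1) :
    α * avarLeft α ν + (1 - α) * avarRight α ν = ∫ z, z ∂ν := by
  have h1 : α ≠ 0 := hα.1.ne'
  have h2 : 1 - α ≠ 0 := (sub_pos.2 hα.2).ne'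
  have hα' : α ∈ Set.Icc (0:ℝ) 1 := Set.Ioo_subset_Icc_self hα
  rw [← integral_comp_quantileFn ν continuous_id',
    ← intervalIntegral.integral_add_adjacent_intervals
      (intervalIntegrable_quantileFn ν hν (by simp) hα')
      (intervalIntegrable_quantileFn ν hν hα' (by simp)), avarLeft, avarRight]
  field_simp

lemma intervalIntegrable_posPart_quantileFn (ν : Measure ℝ) [IsProbabilityMeasure ν]
    (hν : Integrable id ν) (t : ℝ) {a b : ℝ} (ha : a ∈ Set.Icc (0:ℝ) 1)
    (hb : b ∈ Set.Icc (0:ℝ) 1) :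
    IntervalIntegrable (fun τ => max (t - quantileFn ν τ) 0) volume a b := by
  have h : IntervalIntegrable (fun τ => t - quantileFn ν τ) volume a b :=
    intervalIntegrable_const.sub (intervalIntegrable_quantileFn ν hν ha hb)
  exact ⟨h.1.pos_part, h.2.pos_part⟩

lemma sub_integral_posPart_le_avarLeft (ν : Measure ℝ) [IsProbabilityMeasure ν]
    (hν : Integrable id ν) {α : ℝ} (hα : α ∈ Set.Ioo (0:ℝ) 1) (t : ℝ) :
    α * t - ∫ z, max (t - z) 0 ∂ν ≤ α * avarLeft α ν := by
  have hα' : α ∈ Set.Icc (0:ℝ) 1 := Set.Ioo_subset_Icc_self hα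
  have h0 : (0:ℝ) ∈ Set.Icc (0:ℝ) 1 := by simp
  have h1 : (1:ℝ) ∈ Set.Icc (0:ℝ) 1 := by simp
  have hq := intervalIntegrable_quantileFn ν hν h0 hα'
  rw [← integral_comp_quantileFn ν (g := fun z => max (t - z) 0) (by fun_prop),
    ← intervalIntegral.integral_add_adjacent_intervals
      (intervalIntegrable_posPart_quantileFn ν hν t h0 hα')
      (intervalIntegrable_posPart_quantileFn ν hν t hα' h1), avarLeft, ← mul_assoc,
    mul_one_div_cancel hα.1.ne', one_mul]
  have e1 : ∫ τ in (0:ℝ)..α, (t - quantileFn ν τ) ≤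
      ∫ τ in (0:ℝ)..α, max (t - quantileFn ν τ) 0 :=
    intervalIntegral.integral_mono hα.1.le (intervalIntegrable_const.sub hq)
      (intervalIntegrable_posPart_quantileFn ν hν t h0 hα') fun τ => le_max_left _ _
  have e2 : 0 ≤ ∫ τ in α..1, max (t - quantileFn ν τ) 0 :=
    intervalIntegral.integral_nonneg hα.2.le fun τ _ => le_max_right _ _
  rw [intervalIntegral.integral_sub intervalIntegrable_const hq,
    intervalIntegral.integral_const, smul_eq_mul] at e1
  linarith

lemma avarLeft_eq_sub_integral_posPart (ν : Measure ℝ) [IsProbabilityMeasure ν]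
    (hν : Integrable id ν) {α : ℝ} (hα : α ∈ Set.Ioo (0:ℝ) 1) :
    α * avarLeft α ν =
      α * quantileFn ν α - ∫ z, max (quantileFn ν α - z) 0 ∂ν := by
  set t := quantileFn ν α
  have hα' : α ∈ Set.Icc (0:ℝ) 1 := Set.Ioo_subset_Icc_self hα
  have h0 : (0:ℝ) ∈ Set.Icc (0:ℝ) 1 := by simp
  have h1 : (1:ℝ) ∈ Set.Icc (0:ℝ) 1 := by simp
  have hq := intervalIntegrable_quantileFn ν hν h0 hα'
  rw [← integral_comp_quantileFn ν (g := fun z => max (t - z) 0) (by fun_prop),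
    ← intervalIntegral.integral_add_adjacent_intervals
      (intervalIntegrable_posPart_quantileFn ν hν t h0 hα')
      (intervalIntegrable_posPart_quantileFn ν hν t hα' h1), avarLeft, ← mul_assoc,
    mul_one_div_cancel hα.1.ne', one_mul]
  have e1 : ∫ τ in (0:ℝ)..α, max (t - quantileFn ν τ) 0 =
      ∫ τ in (0:ℝ)..α, (t - quantileFn ν τ) := by
    refine intervalIntegral.integral_congr_ae (Filter.Eventually.of_forall fun τ hτ => ?_)
    rw [Set.uIoc_of_le hα.1.le] at hτ
    exact max_eq_left (sub_nonneg.2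
      (monotoneOn_quantileFn ν ⟨hτ.1, hτ.2.trans_lt hα.2⟩ hα hτ.2))
  have e2 : ∫ τ in α..1, max (t - quantileFn ν τ) 0 = 0 := by
    rw [intervalIntegral.integral_of_le hα.2.le, integral_Ioc_eq_integral_Ioo]
    refine setIntegral_eq_zero_of_forall_eq_zero fun τ hτ => ?_
    exact max_eq_right (sub_nonpos.2
      (monotoneOn_quantileFn ν hα ⟨hα.1.trans hτ.1, hτ.2⟩ hτ.1.le))
  rw [e1, e2, intervalIntegral.integral_sub intervalIntegrable_const hq,
    intervalIntegral.integral_const, smul_eq_mul]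
  ring

/-! ### The diatomic measure -/

lemma integrable_diatomicMeasure (M : MDP X A) (α : ℝ) (π : X → A → ℝ)
    (Q : X → A → ℝ × ℝ) (x : X) (a : A) (g : ℝ → ℝ) :
    Integrable g (diatomicMeasure M α π Q x a) := by
  unfold diatomicMeasure
  refine integrable_finsetSum_measure.2 fun x' _ => integrable_finsetSum_measure.2 fun a' _ => ?_
  refine Integrable.smul_measure (Integrable.add_measure ?_ ?_) ENNReal.ofReal_ne_top <;>
  exact (integrable_dirac (by simp)).smul_measure ENNReal.ofReal_ne_top

lemma integral_diatomicMeasure (M : MDP X A) {α : ℝ} (hα : α ∈ Set.Ioo (0:ℝ) 1)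
    {π : X → A → ℝ} (hπ : IsPolicy π) (Q : X → A → ℝ × ℝ) (x : X) (a : A) (g : ℝ → ℝ) :
    ∫ z, g z ∂(diatomicMeasure M α π Q x a) =
      ∑ x', ∑ a', M.P x a x' * π x' a' *
        (α * g (M.r x a x' + M.γ * (Q x' a').1) +
          (1 - α) * g (M.r x a x' + M.γ * (Q x' a').2)) := by
  have hd (c s : ℝ) : Integrable g (ENNReal.ofReal c • Measure.dirac s) :=
    (integrable_dirac (by simp)).smul_measure ENNReal.ofReal_ne_top
  unfold diatomicMeasure
  rw [integral_finsetSum_measure fun x' _ => integrable_finsetSum_measure.2 fun a' _ =>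
    ((hd _ _).add_measure (hd _ _)).smul_measure ENNReal.ofReal_ne_top]
  refine Finset.sum_congr rfl fun x' _ => ?_
  rw [integral_finsetSum_measure fun a' _ =>
    ((hd _ _).add_measure (hd _ _)).smul_measure ENNReal.ofReal_ne_top]
  refine Finset.sum_congr rfl fun a' _ => ?_
  rw [integral_smul_measure, integral_add_measure (hd _ _) (hd _ _), integral_smul_measure,
    integral_smul_measure, integral_dirac, integral_dirac,
    ENNReal.toReal_ofReal (mul_nonneg (M.P_nonneg _ _ _) (hπ.1 _ _)),
    ENNReal.toReal_ofReal hα.1.le, ENNReal.toReal_ofReal (sub_nonneg.2 hα.2.le)]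
  simp only [smul_eq_mul]

lemma isProbabilityMeasure_diatomicMeasure (M : MDP X A) {α : ℝ} (hα : α ∈ Set.Ioo (0:ℝ) 1)
    {π : X → A → ℝ} (hπ : IsPolicy π) (Q : X → A → ℝ × ℝ) (x : X) (a : A) :
    IsProbabilityMeasure (diatomicMeasure M α π Q x a) := by
  have h := integral_diatomicMeasure M hα hπ Q x a fun _ => 1
  have hfin := integrable_diatomicMeasure M α π Q x a fun _ => (1:ℝ)
  simp only [mul_one, add_sub_cancel, ← Finset.mul_sum, hπ.2, M.P_sum_one,
    integral_const, smul_eq_mul] at h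
  refine ⟨?_⟩
  rwa [measureReal_def, ENNReal.toReal_eq_one_iff] at h

lemma integral_diatomicMeasure_of_coherent (M : MDP X A) {α : ℝ} (hα : α ∈ Set.Ioo (0:ℝ) 1)
    {π : X → A → ℝ} (hπ : IsPolicy π) {Q : X → A → ℝ × ℝ} {v₁ v₂ : X → ℝ}
    (hQ : ∀ y a, 0 < π y a → Q y a = (v₁ y, v₂ y)) (x : X) (a : A) (g : ℝ → ℝ) :
    ∫ z, g z ∂(diatomicMeasure M α π Q x a) =
      ∑ x', M.P x a x' * (α * g (M.r x a x' + M.γ * v₁ x') +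
          (1 - α) * g (M.r x a x' + M.γ * v₂ x')) := by
  rw [integral_diatomicMeasure M hα hπ]
  refine Finset.sum_congr rfl fun x' _ => ?_
  calc _ = ∑ a', π x' a' * (M.P x a x' * (α * g (M.r x a x' + M.γ * v₁ x') +
          (1 - α) * g (M.r x a x' + M.γ * v₂ x'))) := by
        refine Finset.sum_congr rfl fun a' _ => ?_
        rcases (hπ.1 x' a').eq_or_lt with h | h
        · simp [← h]
        · rw [hQ x' a' h]; ring
    _ = _ := by rw [← Finset.sum_mul, hπ.2, one_mul]

/-! ### Reduced Bellman equations in the mean and the lower value -/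

/-- Expected shortfall below `t` of the two-atom law with lower atom `r + γ v` whose
underlying mean is `r + γ m`. -/
def shortfall (α γ t r m v : ℝ) : ℝ :=
  α * max (t - (r + γ * v)) 0 + (1 - α) * max (t - (r + γ * ((m - α * v) / (1 - α)))) 0

lemma shortfall_add_le {α : ℝ} (hα : α ∈ Set.Ioo (0:ℝ) 1) (γ t t' r r' m m' v v' : ℝ) :
    shortfall α γ (t + t') (r + r') (m + m') (v + v') ≤
      shortfall α γ t r m v + shortfall α γ t' r' m' v' := by
  have hmax (a b : ℝ) : max (a + b) 0 ≤ max a 0 + max b 0 := by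
    simpa using max_add_add_le_max_add_max (a := a) (b := b) (c := 0) (d := 0)
  have h1 := mul_le_mul_of_nonneg_left
    (hmax (t - (r + γ * v)) (t' - (r' + γ * v'))) hα.1.le
  have h2 := mul_le_mul_of_nonneg_left
    (hmax (t - (r + γ * ((m - α * v) / (1 - α)))) (t' - (r' + γ * ((m' - α * v') / (1 - α)))))
    (sub_nonneg.2 hα.2.le)
  unfold shortfall
  rw [show t + t' - (r + r' + γ * (v + v')) =
      t - (r + γ * v) + (t' - (r' + γ * v')) by ring,
    show t + t' - (r + r' + γ * ((m + m' - α * (v + v')) / (1 - α))) =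
      t - (r + γ * ((m - α * v) / (1 - α))) + (t' - (r' + γ * ((m' - α * v') / (1 - α)))) by ring]
  linarith

lemma shortfall_smul {β : ℝ} (hβ : 0 ≤ β) (α γ t r m v : ℝ) :
    shortfall α γ (β * t) (β * r) (β * m) (β * v) = β * shortfall α γ t r m v := by
  unfold shortfall
  have hmax (a : ℝ) : max (β * a) 0 = β * max a 0 := by
    rw [mul_max_of_nonneg _ _ hβ, mul_zero]
  rw [show β * t - (β * r + γ * (β * v)) = β * (t - (r + γ * v)) by ring,
    show β * t - (β * r + γ * ((β * m - α * (β * v)) / (1 - α))) =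
      β * (t - (r + γ * ((m - α * v) / (1 - α)))) by ring, hmax, hmax]
  ring

lemma shortfall_anti {α γ : ℝ} (hα : α ∈ Set.Ioo (0:ℝ) 1) (hγ : 0 ≤ γ) (t v : ℝ)
    {r r' m m' : ℝ} (hr : r ≤ r') (hm : m ≤ m') :
    shortfall α γ t r' m' v ≤ shortfall α γ t r m v := by
  have h1 := hα.1.le
  have h2 : 0 ≤ 1 - α := sub_nonneg.2 hα.2.le
  unfold shortfall
  gcongr

lemma shortfall_translate {α : ℝ} (hα : α ∈ Set.Ioo (0:ℝ) 1) (γ c t r m v : ℝ) :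
    shortfall α γ (t + c) (r + (1 - γ) * c) (m + c) (v + c) = shortfall α γ t r m v := by
  have h2 : 1 - α ≠ 0 := (sub_pos.2 hα.2).ne'
  unfold shortfall
  have h : (m + c - α * (v + c)) / (1 - α) = (m - α * v) / (1 - α) + c := by
    field_simp
    ring
  rw [h]
  ring_nf

lemma shortfall_le_add {α γ : ℝ} (hα : α ∈ Set.Ioo (0:ℝ) 1) (hγ : 0 ≤ γ) (t r : ℝ)
    {m v w D : ℝ} (hw : w ≤ m) (hD : 0 ≤ D) (hvw : v - w ≤ D) :
    shortfall α γ t r m w ≤ shortfall α γ t r m v + α * γ * D := by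
  have h1 := hα.1
  have h2 : 0 < 1 - α := sub_pos.2 hα.2
  have hαγD : 0 ≤ α * γ * D := by positivity
  unfold shortfall
  set A := t - (r + γ * v) with hA
  set A' := t - (r + γ * w) with hA'
  set B := t - (r + γ * ((m - α * v) / (1 - α))) with hB
  set B' := t - (r + γ * ((m - α * w) / (1 - α))) with hB'
  have hmean : α * A' + (1 - α) * B' = α * A + (1 - α) * B := by
    rw [hA, hA', hB, hB']
    field_simp
    ring
  have hBA' : B' ≤ A' := by
    have : w ≤ (m - α * w) / (1 - α) := by
      rw [le_div_iff₀ h2]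
      linarith
    rw [hA', hB']
    gcongr
  rcases le_total v w with h | h
  · have hAA' : A' ≤ A := by
      rw [hA, hA']
      gcongr
    rcases le_total A' 0 with hA0 | hA0
    · rw [max_eq_right hA0, max_eq_right (hBA'.trans hA0), mul_zero, mul_zero, add_zero]
      positivity
    · rcases le_total B' 0 with hB0 | hB0
      · rw [max_eq_right hB0]
        have : α * max A' 0 ≤ α * max A 0 := by gcongr
        have : 0 ≤ (1 - α) * max B 0 := by positivity
        linarith
      · rw [max_eq_left hB0, max_eq_left hA0]
        have e1 : α * A ≤ α * max A 0 := by gcongr; exact le_max_left _ _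
        have e2 : (1 - α) * B ≤ (1 - α) * max B 0 := by gcongr; exact le_max_left _ _
        linarith
  · have hBB' : B' ≤ B := by
      rw [hB, hB']
      gcongr
    have hγ' : γ * (v - w) ≤ γ * D := by gcongr
    have hAD : max A' 0 ≤ max A 0 + γ * D := by
      refine max_le ?_ (by positivity)
      have := le_max_left A 0
      linarith
    have e1 : α * max A' 0 ≤ α * (max A 0 + γ * D) := by gcongr
    have e2 : (1 - α) * max B' 0 ≤ (1 - α) * max B 0 := by gcongr
    linarith

lemma sum_mul_le_of_forall_le {p f : X → ℝ} {c : ℝ} (hp : ∀ y, 0 ≤ p y)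
    (hp1 : ∑ y, p y = 1) (hf : ∀ y, f y ≤ c) : ∑ y, p y * f y ≤ c := by
  calc ∑ y, p y * f y ≤ ∑ y, p y * c := by
        gcongr with y
        · exact hp y
        · exact hf y
    _ = c := by rw [← Finset.sum_mul, hp1, one_mul]

lemma le_of_sub_le_contraction {γ : ℝ} (hγ : γ < 1) {v w : X → ℝ}
    (h : ∀ D, 0 ≤ D → (∀ y, v y - w y ≤ D) → ∀ y, v y - w y ≤ γ * D) (y : X) : v y ≤ w y := by
  have : Nonempty X := ⟨y⟩
  obtain ⟨y₀, hy₀⟩ := Finite.exists_max fun y => v y - w y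
  rcases le_total (v y₀ - w y₀) 0 with h0 | h0
  · linarith [hy₀ y]
  · have := h _ h0 hy₀ y₀
    nlinarith [hy₀ y]

/-- `m` solves the policy evaluation equation of the reward `r`. -/
def IsMean (γ : ℝ) (p r : X → X → ℝ) (m : X → ℝ) : Prop :=
  ∀ y, m y = ∑ y', p y y' * (r y y' + γ * m y')

lemma IsMean.mono {γ : ℝ} (hγ : 0 ≤ γ) (hγ1 : γ < 1) {p r r' : X → X → ℝ} {m m' : X → ℝ}
    (hp : ∀ y y', 0 ≤ p y y') (hp1 : ∀ y, ∑ y', p y y' = 1)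
    (hm : IsMean γ p r m) (hm' : IsMean γ p r' m') (hr : ∀ y y', r y y' ≤ r' y y') (y : X) :
    m y ≤ m' y := by
  refine le_of_sub_le_contraction hγ1 (fun D _ hD y => ?_) y
  rw [hm y, hm' y, ← Finset.sum_sub_distrib]
  simp only [← mul_sub]
  refine sum_mul_le_of_forall_le (hp y) (hp1 y) fun y' => ?_
  nlinarith [hr y y', hD y']

lemma IsMean.unique {γ : ℝ} (hγ : 0 ≤ γ) (hγ1 : γ < 1) {p r : X → X → ℝ} {m m' : X → ℝ}
    (hp : ∀ y y', 0 ≤ p y y') (hp1 : ∀ y, ∑ y', p y y' = 1)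
    (hm : IsMean γ p r m) (hm' : IsMean γ p r m') : m = m' :=
  funext fun y => le_antisymm (hm.mono hγ hγ1 hp hp1 hm' (fun _ _ => le_rfl) y)
    (hm'.mono hγ hγ1 hp hp1 hm (fun _ _ => le_rfl) y)

lemma IsMean.add {γ : ℝ} {p r r' : X → X → ℝ} {m m' : X → ℝ}
    (hm : IsMean γ p r m) (hm' : IsMean γ p r' m') :
    IsMean γ p (fun y y' => r y y' + r' y y') (fun y => m y + m' y) := by
  intro y
  beta_reduce
  rw [hm y, hm' y, ← Finset.sum_add_distrib]
  exact Finset.sum_congr rfl fun _ _ => by ring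

lemma IsMean.smul {γ : ℝ} {p r : X → X → ℝ} {m : X → ℝ} (β : ℝ) (hm : IsMean γ p r m) :
    IsMean γ p (fun y y' => β * r y y') (fun y => β * m y) := by
  intro y
  beta_reduce
  rw [hm y, Finset.mul_sum]
  exact Finset.sum_congr rfl fun _ _ => by ring

lemma isMean_const {γ : ℝ} {p : X → X → ℝ} (hp1 : ∀ y, ∑ y', p y y' = 1) (c : ℝ) :
    IsMean γ p (fun _ _ => (1 - γ) * c) (fun _ => c) := by
  intro y
  rw [← Finset.sum_mul, hp1]
  ring

/-- `v` is a lower solution of the equation satisfied by the lower value. -/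
def IsLowerSol (α γ : ℝ) (p r : X → X → ℝ) (m v : X → ℝ) : Prop :=
  ∀ y, ∃ t, α * v y ≤ α * t - ∑ y', p y y' * shortfall α γ t (r y y') (m y') (v y')

/-- `w` is an upper solution of the equation satisfied by the lower value. -/
def IsUpperSol (α γ : ℝ) (p r : X → X → ℝ) (m w : X → ℝ) : Prop :=
  (∀ y, w y ≤ m y) ∧
    ∀ y t, α * t - ∑ y', p y y' * shortfall α γ t (r y y') (m y') (w y') ≤ α * w y

lemma IsLowerSol.le_of_isUpperSol {α γ : ℝ} (hα : α ∈ Set.Ioo (0:ℝ) 1) (hγ : 0 ≤ γ)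
    (hγ1 : γ < 1) {p r : X → X → ℝ} {m v w : X → ℝ}
    (hp : ∀ y y', 0 ≤ p y y') (hp1 : ∀ y, ∑ y', p y y' = 1)
    (hv : IsLowerSol α γ p r m v) (hw : IsUpperSol α γ p r m w) (y : X) : v y ≤ w y := by
  refine le_of_sub_le_contraction hγ1 (fun D hD0 hD y => ?_) y
  obtain ⟨t, ht⟩ := hv y
  have h := sum_mul_le_of_forall_le (hp y) (hp1 y) (f := fun y' =>
    shortfall α γ t (r y y') (m y') (w y') - shortfall α γ t (r y y') (m y') (v y'))
    (c := α * γ * D) fun y' => by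
      linarith [shortfall_le_add hα hγ t (r y y') (hw.1 y') hD0 (hD y')]
  simp only [mul_sub, Finset.sum_sub_distrib] at h
  refine le_of_mul_le_mul_left ?_ hα.1
  linarith [hw.2 y t]

lemma IsLowerSol.add {α γ : ℝ} (hα : α ∈ Set.Ioo (0:ℝ) 1) {p r r' : X → X → ℝ}
    {m m' v v' : X → ℝ} (hp : ∀ y y', 0 ≤ p y y') (hv : IsLowerSol α γ p r m v)
    (hv' : IsLowerSol α γ p r' m' v') :
    IsLowerSol α γ p (fun y y' => r y y' + r' y y') (fun y => m y + m' y)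
      (fun y => v y + v' y) := by
  intro y
  obtain ⟨t, ht⟩ := hv y
  obtain ⟨t', ht'⟩ := hv' y
  refine ⟨t + t', ?_⟩
  have h := Finset.sum_le_sum fun y' (_ : y' ∈ Finset.univ) => mul_le_mul_of_nonneg_left
    (shortfall_add_le hα γ t t' (r y y') (r' y y') (m y') (m' y') (v y') (v' y')) (hp y y')
  simp only [mul_add, Finset.sum_add_distrib] at h ⊢
  linarith

lemma IsLowerSol.smul {α γ β : ℝ} (hβ : 0 ≤ β) {p r : X → X → ℝ} {m v : X → ℝ}
    (hv : IsLowerSol α γ p r m v) :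
    IsLowerSol α γ p (fun y y' => β * r y y') (fun y => β * m y) (fun y => β * v y) := by
  intro y
  obtain ⟨t, ht⟩ := hv y
  refine ⟨β * t, ?_⟩
  have h := mul_le_mul_of_nonneg_left ht hβ
  simp only [shortfall_smul hβ, mul_left_comm _ β, ← Finset.mul_sum] at h ⊢
  linarith

lemma IsLowerSol.translate {α γ : ℝ} (hα : α ∈ Set.Ioo (0:ℝ) 1) {p r : X → X → ℝ}
    {m v : X → ℝ} (hv : IsLowerSol α γ p r m v) (c : ℝ) :
    IsLowerSol α γ p (fun y y' => r y y' + (1 - γ) * c) (fun y => m y + c)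
      (fun y => v y + c) := by
  intro y
  obtain ⟨t, ht⟩ := hv y
  refine ⟨t + c, ?_⟩
  simp only [shortfall_translate hα]
  linarith

lemma IsLowerSol.mono {α γ : ℝ} (hα : α ∈ Set.Ioo (0:ℝ) 1) (hγ : 0 ≤ γ)
    {p r r' : X → X → ℝ} {m m' v : X → ℝ} (hp : ∀ y y', 0 ≤ p y y')
    (hv : IsLowerSol α γ p r m v) (hr : ∀ y y', r y y' ≤ r' y y') (hm : ∀ y, m y ≤ m' y) :
    IsLowerSol α γ p r' m' v := by
  intro y
  obtain ⟨t, ht⟩ := hv y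
  refine ⟨t, ht.trans ?_⟩
  gcongr with y'
  · exact hp y y'
  · exact shortfall_anti hα hγ t (v y') (hr y y') (hm y')

/-- A coherent fixed point of the diatomic Bellman operator solves the reduced equations. -/
lemma reduced_equations_of_coherent (M : MDP X A) {α : ℝ} (hα : α ∈ Set.Ioo (0:ℝ) 1)
    {π : X → A → ℝ} (hπ : IsPolicy π) {Q : X → A → ℝ × ℝ} (hfix : diatomicT M α π Q = Q)
    {v₁ v₂ : X → ℝ} (hQ : ∀ y a, 0 < π y a → Q y a = (v₁ y, v₂ y))
    {act : X → A} (hact : ∀ y, 0 < π y (act y)) :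
    ∃ m : X → ℝ,
      IsMean M.γ (fun y => M.P y (act y)) (fun y => M.r y (act y)) m ∧
      IsLowerSol α M.γ (fun y => M.P y (act y)) (fun y => M.r y (act y)) m v₁ ∧
      IsUpperSol α M.γ (fun y => M.P y (act y)) (fun y => M.r y (act y)) m v₁ := by
  have h1α : 1 - α ≠ 0 := (sub_pos.2 hα.2).ne'
  have hint (y : X) (g : ℝ → ℝ) :=
    integral_diatomicMeasure_of_coherent M hα hπ hQ y (act y) g
  have hν (y : X) := isProbabilityMeasure_diatomicMeasure M hα hπ Q y (act y)
  have hid (y : X) := integrable_diatomicMeasure M α π Q y (act y) id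
  have heq (y : X) : diatomicT M α π Q y (act y) = (v₁ y, v₂ y) := by
    rw [hfix, hQ y _ (hact y)]
  have hv₁ (y : X) : avarLeft α (diatomicMeasure M α π Q y (act y)) = v₁ y :=
    congrArg Prod.fst (heq y)
  have hv₂ (y : X) : avarRight α (diatomicMeasure M α π Q y (act y)) = v₂ y :=
    congrArg Prod.snd (heq y)
  set m : X → ℝ := fun y => α * v₁ y + (1 - α) * v₂ y with hm
  have hmean (y : X) : ∫ z, z ∂(diatomicMeasure M α π Q y (act y)) = m y := by
    rw [← avarLeft_add_avarRight _ (hid y) hα, hv₁, hv₂]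
  have hshort (y : X) (t : ℝ) :
      ∫ z, max (t - z) 0 ∂(diatomicMeasure M α π Q y (act y)) =
        ∑ y', M.P y (act y) y' * shortfall α M.γ t (M.r y (act y) y') (m y') (v₁ y') := by
    rw [hint y fun z => max (t - z) 0]
    refine Finset.sum_congr rfl fun y' _ => ?_
    rw [shortfall, show (m y' - α * v₁ y') / (1 - α) = v₂ y' by
      simp only [hm]; field_simp; ring]
  refine ⟨m, fun y => ?_, fun y => ⟨quantileFn (diatomicMeasure M α π Q y (act y)) α, ?_⟩,
    fun y => ?_, fun y t => ?_⟩
  · rw [← hmean y, hint y fun z => z]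
    refine Finset.sum_congr rfl fun y' _ => ?_
    simp only [hm]
    ring
  · rw [← hv₁ y, avarLeft_eq_sub_integral_posPart _ (hid y) hα, hshort]
  · have hopt := avarLeft_eq_sub_integral_posPart _ (hid y) hα
    rw [hv₁] at hopt
    set t := quantileFn (diatomicMeasure M α π Q y (act y)) α
    have hle : t - m y ≤ ∫ z, max (t - z) 0 ∂(diatomicMeasure M α π Q y (act y)) := by
      calc t - m y = ∫ z, (t - z) ∂(diatomicMeasure M α π Q y (act y)) := by
            rw [integral_sub (integrable_const t) (integrable_diatomicMeasure M α π Q y (act y) _), hmean]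
            simp
        _ ≤ _ := integral_mono (integrable_diatomicMeasure M α π Q y (act y) _)
            (integrable_diatomicMeasure M α π Q y (act y) _) fun z => le_max_left _ _
    have hnonneg : 0 ≤ ∫ z, max (t - z) 0 ∂(diatomicMeasure M α π Q y (act y)) :=
      integral_nonneg fun z => le_max_right _ _
    refine le_of_mul_le_mul_left ?_ hα.1
    rcases le_total t (m y) with h | h
    · nlinarith [mul_le_mul_of_nonneg_left h hα.1.le]
    · nlinarith [mul_nonneg (sub_nonneg.2 h) (sub_nonneg.2 hα.2.le)]
  · rw [← hshort, ← hv₁ y]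
    exact sub_integral_posPart_le_avarLeft _ (hid y) hα t

theorem stmt12 (M : MDP X A) (α : ℝ) (hα : α ∈ Set.Ioo (0:ℝ) 1) (x : X)
    (π : X → A → ℝ) (hπ : IsPolicy π)
    (Qfix : (X → A → X → ℝ) → X → A → ℝ × ℝ)
    (hfix : ∀ rw : X → A → X → ℝ,
      diatomicT { M with r := rw } α π (Qfix rw) = Qfix rw)
    (V1 V2 : (X → A → X → ℝ) → X → ℝ)
    (hcoh : ∀ (rw : X → A → X → ℝ) (y : X) (a : A), 0 < π y a →
      Qfix rw y a = (V1 rw y, V2 rw y))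
    (ρ : (X → A → X → ℝ) → ℝ)
    (hρ : ∀ rw, ρ rw = -((1 - M.γ) * V1 rw x)) :
    (∀ (rw : X → A → X → ℝ) (β : ℝ),
        ρ (fun y a y' => rw y a y' + β) = ρ rw - β) ∧
    (∀ r1 r2 : X → A → X → ℝ,
        ρ (fun y a y' => r1 y a y' + r2 y a y') ≤ ρ r1 + ρ r2) ∧
    (∀ (β : ℝ) (rw : X → A → X → ℝ), 0 ≤ β →
        ρ (fun y a y' => β * rw y a y') = β * ρ rw) ∧
    (∀ r1 r2 : X → A → X → ℝ, (∀ y a y', r1 y a y' ≤ r2 y a y') →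
        ρ r2 ≤ ρ r1) := by
  have hact (y : X) : ∃ a, 0 < π y a := by
    by_contra! h
    have := Finset.sum_nonpos fun a (_ : a ∈ Finset.univ) => h a
    linarith [hπ.2 y]
  choose act hact using hact
  set p : X → X → ℝ := fun y => M.P y (act y)
  have hp : ∀ y y', 0 ≤ p y y' := fun y => M.P_nonneg y (act y)
  have hp1 : ∀ y, ∑ y', p y y' = 1 := fun y => M.P_sum_one y (act y)
  have hγ := M.γ_nonneg
  have hγ1 := M.γ_lt_one
  have h1γ : 0 < 1 - M.γ := sub_pos.2 hγ1
  have hsol (rw : X → A → X → ℝ) :=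
    reduced_equations_of_coherent { M with r := rw } hα hπ (hfix rw) (hcoh rw) hact
  choose m hmean hlow hup using hsol
  replace hmean : ∀ rw, IsMean M.γ p (fun y => rw y (act y)) (m rw) := hmean
  replace hlow : ∀ rw, IsLowerSol α M.γ p (fun y => rw y (act y)) (m rw) (V1 rw) := hlow
  replace hup : ∀ rw, IsUpperSol α M.γ p (fun y => rw y (act y)) (m rw) (V1 rw) := hup
  have compare (rw : X → A → X → ℝ) (μ v : X → ℝ)
      (hμ : IsMean M.γ p (fun y => rw y (act y)) μ)
      (hv : IsLowerSol α M.γ p (fun y => rw y (act y)) μ v) : v x ≤ V1 rw x := by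
    rw [hμ.unique hγ hγ1 hp hp1 (hmean rw)] at hv
    exact hv.le_of_isUpperSol hα hγ hγ1 hp hp1 (hup rw) x
  have trans_le (rw : X → A → X → ℝ) (c : ℝ) :
      V1 rw x + c ≤ V1 (fun y a y' => rw y a y' + (1 - M.γ) * c) x :=
    compare _ (fun y => m rw y + c) (fun y => V1 rw y + c)
      ((hmean rw).add (isMean_const hp1 c)) ((hlow rw).translate hα c)
  have add_le (r1 r2 : X → A → X → ℝ) :
      V1 r1 x + V1 r2 x ≤ V1 (fun y a y' => r1 y a y' + r2 y a y') x :=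
    compare _ (fun y => m r1 y + m r2 y) (fun y => V1 r1 y + V1 r2 y)
      ((hmean r1).add (hmean r2)) ((hlow r1).add hα hp (hlow r2))
  have smul_le (β : ℝ) (hβ : 0 ≤ β) (rw : X → A → X → ℝ) :
      β * V1 rw x ≤ V1 (fun y a y' => β * rw y a y') x :=
    compare _ (fun y => β * m rw y) (fun y => β * V1 rw y) ((hmean rw).smul β) ((hlow rw).smul hβ)
  refine ⟨fun rw β => ?_, fun r1 r2 => ?_, fun β rw hβ => ?_, fun r1 r2 hr => ?_⟩
  · obtain ⟨c, rfl⟩ : ∃ c, β = (1 - M.γ) * c := ⟨β / (1 - M.γ), by field_simp⟩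
    have h := trans_le (fun y a y' => rw y a y' + (1 - M.γ) * c) (-c)
    simp only [mul_neg, add_neg_cancel_right] at h
    have hV : V1 (fun y a y' => rw y a y' + (1 - M.γ) * c) x = V1 rw x + c :=
      le_antisymm (by linarith) (trans_le rw c)
    rw [hρ, hρ, hV]
    ring
  · rw [hρ, hρ, hρ]
    nlinarith [mul_le_mul_of_nonneg_left (add_le r1 r2) h1γ.le]
  · have hV : V1 (fun y a y' => β * rw y a y') x = β * V1 rw x := by
      refine le_antisymm ?_ (smul_le β hβ rw)
      rcases hβ.eq_or_lt with rfl | hpos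
      · have h := smul_le 2 zero_le_two fun y a y' => 0 * rw y a y'
        simp only [zero_mul, mul_zero] at h ⊢
        linarith
      · have h := smul_le β⁻¹ (inv_nonneg.2 hβ) fun y a y' => β * rw y a y'
        simp only [inv_mul_cancel_left₀ hpos.ne'] at h
        rwa [inv_mul_le_iff₀ hpos] at h
    rw [hρ, hρ, hV]
    ring
  · have hle : V1 r1 x ≤ V1 r2 x :=
      compare r2 (m r2) (V1 r1) (hmean r2) ((hlow r1).mono hα hγ hp (fun y y' => hr y (act y) y')
        ((hmean r1).mono hγ hγ1 hp hp1 (hmean r2) fun y y' => hr y (act y) y'))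
    rw [hρ, hρ]
    nlinarith [mul_le_mul_of_nonneg_left hle h1γ.le]

end
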